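/- Fix integers d, d', n, b with 1 ≤ b ≤ n, a step-size η > 0, a dataset X̂ = (x̂_1, …, x̂_n) in ℝ^{d'} with ‖x̂_i‖ ≤ D for all i, and a measurable map g : ℝ^d × ℝ^{d'} → ℝ^d. Assume Assumption 1 and Assumption 3, that η < min{1/m, m/(K_1² + 64D²K_2²)}, and let θ̂_* ∈ ℝ^d satisfy (1/n)Σ_{i=1}^n g(θ̂_*, x̂_i) = 0. Let Ω_1 be a uniformly distributed random subset of {1, …, n} of cardinality b and let ξ be an ℝ^d-valued random vector independent of Ω_1 with E[ξ] = 0 and E‖ξ‖² = σ² < ∞. Fix θ ∈ ℝ^d and set θ̂_1 = θ − (η/b)Σ_{i∈Ω_1} g(θ, x̂_i) + ηξ. Then E[1 + ‖θ̂_1 − θ̂_*‖²] ≤ (1 − mη)(1 + ‖θ − θ̂_*‖²) + 2mη − η²K_1² − 56η²D²K_2² + 64η²D²K_2²‖θ̂_*‖² + 2ηK + η²σ². -/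

import Mathlib

open MeasureTheory ProbabilityTheory
open scoped InnerProductSpace ENNReal

theorem sum_powersetCard_univ_sum {ι E : Type*} [Fintype ι] [AddCommMonoid E]
    {k : ℕ} (hk : 1 ≤ k) (w : ι → E) :
    ∑ s ∈ Finset.powersetCard k (Finset.univ : Finset ι), ∑ i ∈ s, w i
      = (Fintype.card ι - 1).choose (k - 1) • ∑ i, w i := by
  classical
  rw [Finset.sum_comm' (t' := Finset.univ)
    (s' := fun i => (Finset.powersetCard k Finset.univ).filter ({i} ⊆ ·)) (by simp)]
  rw [Finset.smul_sum]
  refine Finset.sum_congr rfl fun i _ => ?_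
  rw [Finset.sum_const, Finset.card_filter_powersetCard_subset _ _ _ (by simp) (by simpa using hk)]
  simp

theorem setIntegral_comp_eq_measureReal_mul {Ω E : Type*} [MeasurableSpace Ω] [MeasurableSpace E]
    {P : Measure Ω} {A : Set Ω} {ξ : Ω → E} (hξ : Measurable ξ)
    (hA : ∀ B : Set E, MeasurableSet B → P (A ∩ ξ ⁻¹' B) = P A * P (ξ ⁻¹' B))
    {f : E → ℝ} (hf : Measurable f) :
    ∫ ω in A, f (ξ ω) ∂P = P.real A * ∫ ω, f (ξ ω) ∂P := by
  have hmap : (P.restrict A).map ξ = P A • P.map ξ := by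
    ext B hB
    rw [Measure.map_apply hξ hB, Measure.restrict_apply (hξ hB), Measure.smul_apply,
      Measure.map_apply hξ hB, Set.inter_comm, hA B hB, smul_eq_mul]
  rw [← integral_map hξ.aemeasurable hf.aestronglyMeasurable,
    ← integral_map hξ.aemeasurable hf.aestronglyMeasurable, hmap, integral_smul_measure]
  rfl

theorem integral_eq_sum_measureReal_mul {Ω ι E : Type*} [MeasurableSpace Ω] [MeasurableSpace E]
    [Fintype ι] {P : Measure Ω} {S : Ω → ι} {ξ : Ω → E}
    (hS : ∀ s, MeasurableSet {ω | S ω = s}) (hξ : Measurable ξ)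
    (hindep : ∀ (s : ι) (B : Set E), MeasurableSet B →
      P ({ω | S ω = s} ∩ ξ ⁻¹' B) = P {ω | S ω = s} * P (ξ ⁻¹' B))
    {F : ι → E → ℝ} (hF : ∀ s, Measurable (F s))
    (hFi : ∀ s, Integrable (fun ω => F s (ξ ω)) P) :
    ∫ ω, F (S ω) (ξ ω) ∂P = ∑ s, P.real {ω | S ω = s} * ∫ ω, F s (ξ ω) ∂P := by
  have hU : (⋃ s, {ω | S ω = s}) = Set.univ := by ext; simp
  rw [← setIntegral_univ, ← hU, integral_iUnion_fintype hS]
  · refine Finset.sum_congr rfl fun s _ => ?_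
    rw [← setIntegral_comp_eq_measureReal_mul hξ (hindep s) (hF s)]
    exact setIntegral_congr_fun (hS s) fun ω (hω : S ω = s) => by simp only [hω]
  · intro s t hst
    exact Set.disjoint_left.2 fun ω (hs : S ω = s) (ht : S ω = t) => hst (hs ▸ ht)
  · intro s
    exact (hFi s).integrableOn.congr_fun (fun ω (hω : S ω = s) => by simp only [hω]) (hS s)

section CenteredNoise

variable {Ω E : Type*} [MeasurableSpace Ω] [NormedAddCommGroup E] [InnerProductSpace ℝ E]
  {P : Measure Ω} [IsProbabilityMeasure P] {ξ : Ω → E}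

theorem integrable_norm_add_smul_sq (hξ : Integrable ξ P)
    (hξ2 : Integrable (fun ω => ‖ξ ω‖ ^ 2) P) (a : E) (c : ℝ) :
    Integrable (fun ω => ‖a + c • ξ ω‖ ^ 2) P := by
  simp only [norm_add_sq_real, inner_smul_right, norm_smul, mul_pow]
  exact ((integrable_const _).add (((hξ.const_inner a).const_mul c).const_mul 2)).add
    (hξ2.const_mul _)

theorem integral_norm_add_smul_sq [CompleteSpace E] (hξ : Integrable ξ P)
    (hmean : ∫ ω, ξ ω ∂P = 0) (hξ2 : Integrable (fun ω => ‖ξ ω‖ ^ 2) P) (a : E) (c : ℝ) :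
    ∫ ω, ‖a + c • ξ ω‖ ^ 2 ∂P = ‖a‖ ^ 2 + c ^ 2 * ∫ ω, ‖ξ ω‖ ^ 2 ∂P := by
  have h1 : Integrable (fun ω => 2 * (c * ⟪a, ξ ω⟫_ℝ)) P :=
    ((hξ.const_inner a).const_mul c).const_mul 2
  simp only [norm_add_sq_real, inner_smul_right, norm_smul, mul_pow, Real.norm_eq_abs, sq_abs]
  rw [integral_add (f := fun ω => ‖a‖ ^ 2 + 2 * (c * ⟪a, ξ ω⟫_ℝ))
      ((integrable_const _).add h1) (hξ2.const_mul _),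
    integral_add (integrable_const _) h1, integral_const_mul, integral_const_mul,
    integral_const_mul, integral_inner hξ, hmean]
  simp

end CenteredNoise

theorem norm_sub_average_le {ι E : Type*} [Fintype ι] [Nonempty ι] [NormedAddCommGroup E]
    [NormedSpace ℝ E] {v : ι → E} {a : E} {r : ℝ} (h : ∀ j, ‖a - v j‖ ≤ r) :
    ‖a - (1 / (Fintype.card ι : ℝ)) • ∑ j, v j‖ ≤ r := by
  have hn : (0 : ℝ) < Fintype.card ι := by exact_mod_cast Fintype.card_pos
  have heq : a - (1 / (Fintype.card ι : ℝ)) • ∑ j, v j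
      = (1 / (Fintype.card ι : ℝ)) • ∑ j, (a - v j) := by
    rw [Finset.sum_sub_distrib, smul_sub, Finset.sum_const, Finset.card_univ,
      ← Nat.cast_smul_eq_nsmul ℝ, smul_smul, one_div_mul_cancel hn.ne', one_smul]
  rw [heq, norm_smul, Real.norm_of_nonneg (by positivity), one_div, inv_mul_le_iff₀ hn]
  refine (norm_sum_le _ _).trans ((Finset.sum_le_sum fun j _ => h j).trans ?_)
  simp

/-- The mean square of `v - (c / k) • ∑ i ∈ s, w i` over all `k`-subsets `s`, for a family `w` of
vectors of norm at most `r` that sums to zero. -/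
theorem sum_powersetCard_norm_sub_smul_sum_sq_le {ι E : Type*} [Fintype ι]
    [NormedAddCommGroup E] [InnerProductSpace ℝ E] {k : ℕ} (hk : 1 ≤ k) {w : ι → E}
    (hw : ∑ i, w i = 0) {r : ℝ} (hr : ∀ i, ‖w i‖ ≤ r) (v : E) (c : ℝ) :
    ∑ s ∈ Finset.powersetCard k (Finset.univ : Finset ι), ‖v - (c / (k : ℝ)) • ∑ i ∈ s, w i‖ ^ 2
      ≤ (Fintype.card ι).choose k * (‖v‖ ^ 2 + c ^ 2 * r ^ 2) := by
  have hk0 : (0 : ℝ) < k := by exact_mod_cast hk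
  have hs : ∀ s ∈ Finset.powersetCard k (Finset.univ : Finset ι),
      ‖v - (c / (k : ℝ)) • ∑ i ∈ s, w i‖ ^ 2
        ≤ ‖v‖ ^ 2 + c ^ 2 * r ^ 2 - 2 * (c / k) * ⟪v, ∑ i ∈ s, w i⟫_ℝ := by
    intro s hs
    have hsum : ‖∑ i ∈ s, w i‖ ≤ k * r := by
      refine (norm_sum_le_of_le s fun i _ => hr i).trans ?_
      simp [(Finset.mem_powersetCard.1 hs).2]
    have hsq : ‖∑ i ∈ s, w i‖ ^ 2 ≤ (k * r) ^ 2 := pow_le_pow_left₀ (norm_nonneg _) hsum 2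
    have hc : (c / k) ^ 2 * ‖∑ i ∈ s, w i‖ ^ 2 ≤ c ^ 2 * r ^ 2 := by
      refine (mul_le_mul_of_nonneg_left hsq (sq_nonneg _)).trans_eq ?_
      field_simp
    rw [norm_sub_sq_real, inner_smul_right, norm_smul, mul_pow, Real.norm_eq_abs, sq_abs]
    linarith
  refine (Finset.sum_le_sum hs).trans_eq ?_
  rw [Finset.sum_sub_distrib, ← Finset.mul_sum, ← inner_sum, sum_powersetCard_univ_sum hk, hw]
  simp [mul_add]

/-- Lemma C.3 / lem:nonconvex:2: one-step Lyapunov drift for noisy SGD under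
dissipativity.  With `θ̂₁ = θ - (η/b) ∑_{i∈Ω₁} g(θ, x̂ᵢ) + η ξ`, where `Ω₁` is a uniformly
distributed minibatch of size `b` and `ξ` is a centered noise, independent of `Ω₁`, with
`E‖ξ‖² = σ²`, under Assumptions 1 and 3 and `η < min{1/m, m/(K₁² + 64 D² K₂²)}`,
`E[1 + ‖θ̂₁-θ̂_*‖²] ≤ (1-mη)(1+‖θ-θ̂_*‖²) + 2mη - η²K₁² - 56η²D²K₂² + 64η²D²K₂²‖θ̂_*‖²
  + 2ηK + η²σ²`. -/
theorem stmt_10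
    {Ωs : Type*} [MeasurableSpace Ωs] (P : Measure Ωs) [IsProbabilityMeasure P]
    (d d' n b : ℕ) (hb : 1 ≤ b) (hbn : b ≤ n)
    (η D K1 K2 m K σ : ℝ) (hη : 0 < η) (hD : 0 < D) (hK1 : 0 < K1) (hK2 : 0 < K2)
    (hm : 0 < m) (hK : 0 < K)
    (g : EuclideanSpace ℝ (Fin d) → EuclideanSpace ℝ (Fin d') → EuclideanSpace ℝ (Fin d))
    (hgmeas : Measurable (Function.uncurry g))
    -- Assumption 1 (pseudo-Lipschitz gradient):
    (hA1 : ∀ (θ θ' : EuclideanSpace ℝ (Fin d)) (z z' : EuclideanSpace ℝ (Fin d')),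
      ‖g θ z - g θ' z'‖ ≤ K1 * ‖θ - θ'‖ + K2 * ‖z - z'‖ * (‖θ‖ + ‖θ'‖ + 1))
    -- Assumption 3 (dissipativity):
    (hA3 : ∀ (θ1 θ2 : EuclideanSpace ℝ (Fin d)) (z : EuclideanSpace ℝ (Fin d')),
      m * ‖θ1 - θ2‖ ^ 2 - K ≤ ⟪g θ1 z - g θ2 z, θ1 - θ2⟫_ℝ)
    -- step-size condition:
    (hηsmall : η < min (1 / m) (m / (K1 ^ 2 + 64 * D ^ 2 * K2 ^ 2)))
    -- the dataset, bounded by D: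
    (xh : Fin n → EuclideanSpace ℝ (Fin d')) (hxhD : ∀ i, ‖xh i‖ ≤ D)
    -- θ̂_* is a critical point of the empirical risk:
    (θstar : EuclideanSpace ℝ (Fin d))
    (hθstar : (1 / (n : ℝ)) • ∑ i : Fin n, g θstar (xh i) = 0)
    -- Ω₁ is a uniformly distributed random subset of {1,…,n} of cardinality b:
    (S : Ωs → Finset (Fin n))
    (hScard : ∀ ω, (S ω).card = b)
    (hSmeas : ∀ s : Finset (Fin n), MeasurableSet {ω | S ω = s})
    (hSunif : ∀ s : Finset (Fin n), s.card = b →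
      P {ω | S ω = s} = 1 / (n.choose b : ℝ≥0∞))
    -- ξ is a centered noise with E‖ξ‖² = σ² < ∞, independent of Ω₁:
    (ξ : Ωs → EuclideanSpace ℝ (Fin d)) (hξmeas : Measurable ξ)
    (hξint : Integrable ξ P) (hξmean : (∫ ω, ξ ω ∂P) = 0)
    (hξ2int : Integrable (fun ω => ‖ξ ω‖ ^ 2) P)
    (hξvar : (∫ ω, ‖ξ ω‖ ^ 2 ∂P) = σ ^ 2)
    (hindep : ∀ (s : Finset (Fin n)) (A : Set (EuclideanSpace ℝ (Fin d))),
      MeasurableSet A →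
        P ({ω | S ω = s} ∩ ξ ⁻¹' A) = P {ω | S ω = s} * P (ξ ⁻¹' A))
    -- one noisy SGD step from θ₀:
    (θ₀ : EuclideanSpace ℝ (Fin d))
    (θh1 : Ωs → EuclideanSpace ℝ (Fin d))
    (hθh1 : ∀ ω, θh1 ω = θ₀ - (η / (b : ℝ)) • ∑ i ∈ S ω, g θ₀ (xh i) + η • ξ ω) :
    (∫ ω, (1 + ‖θh1 ω - θstar‖ ^ 2) ∂P)
      ≤ (1 - m * η) * (1 + ‖θ₀ - θstar‖ ^ 2)
        + 2 * m * η - η ^ 2 * K1 ^ 2 - 56 * η ^ 2 * D ^ 2 * K2 ^ 2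
        + 64 * η ^ 2 * D ^ 2 * K2 ^ 2 * ‖θstar‖ ^ 2
        + 2 * η * K + η ^ 2 * σ ^ 2 := by
  have hn : 0 < n := by omega
  have : Nonempty (Fin n) := ⟨⟨0, hn⟩⟩
  have hn0 : (n : ℝ) ≠ 0 := by positivity
  have hb0 : (b : ℝ) ≠ 0 := by positivity
  have hC : (0 : ℝ) < n.choose b := by exact_mod_cast Nat.choose_pos hbn
  set u := θ₀ - θstar with hu
  set G := (1 / (n : ℝ)) • ∑ i, g θ₀ (xh i) with hG
  set r := 2 * D * K2 * (2 * ‖θ₀‖ + 1) with hr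
  clear_value u G r
  have hnG : ∑ i, g θ₀ (xh i) = (n : ℝ) • G := by
    rw [hG, smul_smul, mul_one_div_cancel hn0, one_smul]
  have hstar : ∑ i, g θstar (xh i) = 0 := (smul_eq_zero_iff_right (by positivity)).1 hθstar
  have hw0 : ∑ i, (g θ₀ (xh i) - G) = 0 := by
    rw [Finset.sum_sub_distrib, hnG]
    simp [← Nat.cast_smul_eq_nsmul ℝ]
  have hwr : ∀ i, ‖g θ₀ (xh i) - G‖ ≤ r := by
    intro i
    have h := norm_sub_average_le (v := fun j => g θ₀ (xh j)) (a := g θ₀ (xh i))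
      (r := r) fun j => by
      have hz : ‖xh i - xh j‖ ≤ 2 * D := by
        linarith [norm_sub_le (xh i) (xh j), hxhD i, hxhD j]
      calc ‖g θ₀ (xh i) - g θ₀ (xh j)‖
          ≤ K2 * ‖xh i - xh j‖ * (2 * ‖θ₀‖ + 1) := by
            refine (hA1 θ₀ θ₀ (xh i) (xh j)).trans_eq ?_
            rw [sub_self, norm_zero]; ring
        _ ≤ K2 * (2 * D) * (2 * ‖θ₀‖ + 1) := by gcongr
        _ = r := by rw [hr]; ring
    simpa [hG] using h
  have hGnorm : ‖G‖ ≤ K1 * ‖u‖ := by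
    have hsum : ‖∑ i, g θ₀ (xh i)‖ ≤ n * (K1 * ‖u‖) := by
      rw [← sub_zero (∑ i, g θ₀ (xh i)), ← hstar, ← Finset.sum_sub_distrib]
      refine (norm_sum_le_of_le (n := fun _ => K1 * ‖u‖) _ fun i _ => ?_).trans_eq (by simp)
      simpa [hu] using hA1 θ₀ θstar (xh i) (xh i)
    rw [hnG, norm_smul, Real.norm_of_nonneg (by positivity)] at hsum
    exact le_of_mul_le_mul_left hsum (by positivity)
  have hdiss : m * ‖u‖ ^ 2 - K ≤ ⟪u, G⟫_ℝ := by
    have hsum : ∑ _i : Fin n, (m * ‖u‖ ^ 2 - K)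
        ≤ ∑ i, ⟪g θ₀ (xh i) - g θstar (xh i), u⟫_ℝ :=
      Finset.sum_le_sum fun i _ => hu ▸ hA3 θ₀ θstar (xh i)
    rw [← sum_inner, Finset.sum_sub_distrib (fun i => g θ₀ (xh i)), hstar, sub_zero, hnG,
      real_inner_smul_left, real_inner_comm, Finset.sum_const, Finset.card_univ, Fintype.card_fin,
      nsmul_eq_mul] at hsum
    exact le_of_mul_le_mul_left hsum (by positivity)
  -- Averaging over the minibatch and the noise.
  have hp : ∀ s : Finset (Fin n), s ∉ Finset.powersetCard b Finset.univ →
      P.real {ω | S ω = s} = 0 := by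
    intro s hs
    have : {ω | S ω = s} = ∅ := by
      refine Set.eq_empty_of_forall_notMem fun ω (hω : S ω = s) => hs ?_
      simp [← hω, hScard]
    simp [this]
  have hp' : ∀ s ∈ Finset.powersetCard b (Finset.univ : Finset (Fin n)),
      P.real {ω | S ω = s} = 1 / (n.choose b : ℝ) := by
    intro s hs
    simp [Measure.real, hSunif s (Finset.mem_powersetCard.1 hs).2]
  have hmean : ∫ ω, (1 + ‖θh1 ω - θstar‖ ^ 2) ∂P = 1 / (n.choose b : ℝ) *
      ∑ s ∈ Finset.powersetCard b (Finset.univ : Finset (Fin n)),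
        (‖(u - η • G) - (η / (b : ℝ)) • ∑ i ∈ s, (g θ₀ (xh i) - G)‖ ^ 2
          + (1 + η ^ 2 * σ ^ 2)) := by
    have hF : ∀ ω, ‖θh1 ω - θstar‖ ^ 2
        = ‖(u - (η / (b : ℝ)) • ∑ i ∈ S ω, g θ₀ (xh i)) + η • ξ ω‖ ^ 2 := by
      intro ω
      rw [hθh1 ω, hu]
      congr 2
      abel
    simp only [hF]
    rw [integral_eq_sum_measureReal_mul hSmeas hξmeas hindep
      (F := fun s x => 1 + ‖(u - (η / (b : ℝ)) • ∑ i ∈ s, g θ₀ (xh i)) + η • x‖ ^ 2)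
      (fun s => by fun_prop)
      (fun s => (integrable_const _).add (integrable_norm_add_smul_sq hξint hξ2int _ _)),
      ← Finset.sum_subset (Finset.subset_univ (Finset.powersetCard b Finset.univ))
        (fun s _ hs => by rw [hp s hs, zero_mul]), Finset.mul_sum]
    refine Finset.sum_congr rfl fun s hs => ?_
    rw [hp' s hs,
      integral_add (integrable_const _) (integrable_norm_add_smul_sq hξint hξ2int _ _),
      integral_norm_add_smul_sq hξint hξmean hξ2int, hξvar, Finset.sum_sub_distrib,
      Finset.sum_const, (Finset.mem_powersetCard.1 hs).2, ← Nat.cast_smul_eq_nsmul ℝ, smul_sub,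
      smul_smul, div_mul_cancel₀ _ hb0, sub_sub, add_sub_cancel]
    simp only [integral_const, probReal_univ, smul_eq_mul, mul_one]
    ring
  have hbatch : ∫ ω, (1 + ‖θh1 ω - θstar‖ ^ 2) ∂P
      ≤ 1 + ‖u - η • G‖ ^ 2 + η ^ 2 * r ^ 2 + η ^ 2 * σ ^ 2 := by
    have h := sum_powersetCard_norm_sub_smul_sum_sq_le hb hw0 hwr (u - η • G) η
    rw [Fintype.card_fin] at h
    rw [hmean, Finset.sum_add_distrib, Finset.sum_const, Finset.card_powersetCard,
      Finset.card_univ, Fintype.card_fin, nsmul_eq_mul, one_div, inv_mul_le_iff₀ hC]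
    linarith
  have hstep : ‖u - η • G‖ ^ 2
      ≤ ‖u‖ ^ 2 - 2 * η * (m * ‖u‖ ^ 2 - K) + η ^ 2 * (K1 ^ 2 * ‖u‖ ^ 2) := by
    have hG2 : ‖G‖ ^ 2 ≤ K1 ^ 2 * ‖u‖ ^ 2 := by
      rw [← mul_pow]; exact pow_le_pow_left₀ (norm_nonneg _) hGnorm 2
    rw [norm_sub_sq_real, inner_smul_right, norm_smul, mul_pow, Real.norm_eq_abs, sq_abs]
    have h1 := mul_le_mul_of_nonneg_left hG2 (sq_nonneg η)
    have h2 := mul_le_mul_of_nonneg_left hdiss hη.le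
    linarith
  have hr2 : r ^ 2 ≤ 64 * D ^ 2 * K2 ^ 2 * (‖u‖ ^ 2 + ‖θstar‖ ^ 2) + 8 * D ^ 2 * K2 ^ 2 := by
    have htri : ‖θ₀‖ ≤ ‖u‖ + ‖θstar‖ := by
      simpa [hu] using norm_add_le (θ₀ - θstar) θstar
    have hθ2 : ‖θ₀‖ ^ 2 ≤ 2 * (‖u‖ ^ 2 + ‖θstar‖ ^ 2) := by
      have := pow_le_pow_left₀ (norm_nonneg _) htri 2
      linarith [sq_nonneg (‖u‖ - ‖θstar‖)]
    have h : (2 * ‖θ₀‖ + 1) ^ 2 ≤ 16 * (‖u‖ ^ 2 + ‖θstar‖ ^ 2) + 2 := by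
      linarith [sq_nonneg (2 * ‖θ₀‖ - 1)]
    have := mul_le_mul_of_nonneg_left h (by positivity : 0 ≤ 4 * D ^ 2 * K2 ^ 2)
    rw [hr]
    linarith
  have hηm : η * (K1 ^ 2 + 64 * D ^ 2 * K2 ^ 2) ≤ m :=
    ((lt_div_iff₀ (by positivity)).1 (lt_min_iff.1 hηsmall).2).le
  have hfin := mul_le_mul_of_nonneg_left hηm (by positivity : 0 ≤ η * (1 + ‖u‖ ^ 2))
  have hr3 := mul_le_mul_of_nonneg_left hr2 (sq_nonneg η)
  linarith
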